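/- Let p be an odd prime. Then [2p+2 choose p]_q ≡ 1 + q^p (mod [p]_{q²}) in ℤ[q], where [p]_{q²} = 1 + q² + q⁴ + ⋯ + q^{2(p−1)}. -/

import Mathlib

open Polynomial

/-- The Gaussian (q-)binomial coefficient [n choose m]_q ∈ ℤ[q], defined via the
Pascal-type recurrence [n+1 choose m]_q = q^m [n choose m]_q + [n choose m-1]_q;
it equals ((1-q^n)⋯(1-q^(n-m+1)))/((1-q^m)⋯(1-q)) for 0 ≤ m ≤ n and is 0 for m > n. -/
noncomputable def qbinom : ℕ → ℕ → Polynomial ℤ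
  | _, 0 => 1
  | 0, _ + 1 => 0
  | n + 1, m + 1 => X ^ (m + 1) * qbinom n (m + 1) + qbinom n m

lemma qb_lt : ∀ n m : ℕ, n < m → qbinom n m = 0
  | _, 0, h => by omega
  | 0, _ + 1, _ => by simp [qbinom]
  | n + 1, m + 1, h => by
      rw [qbinom, qb_lt n (m + 1) (by omega), qb_lt n m (by omega)]; simp

lemma qb_self : ∀ n : ℕ, qbinom n n = 1
  | 0 => by simp [qbinom]
  | n + 1 => by rw [qbinom, qb_lt n (n + 1) (by omega), qb_self n]; simp

noncomputable def qP (n : ℕ) : Polynomial ℤ := ∏ i ∈ Finset.range n, (1 - X ^ (i + 1))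

lemma qP_succ (n : ℕ) : qP (n + 1) = qP n * (1 - X ^ (n + 1)) := Finset.prod_range_succ _ _

lemma qP_ne (n : ℕ) : qP n ≠ 0 := by
  refine Finset.prod_ne_zero_iff.2 fun i _ h => ?_
  have := congrArg (Polynomial.eval 0) h
  simp at this

lemma qb_prod : ∀ n m : ℕ, qbinom (n + m) m * qP m * qP n = qP (n + m)
  | 0, m => by simp [qb_self, qP]
  | n + 1, 0 => by simp [qbinom, qP]
  | n + 1, m + 1 => by
      have h1 := qb_prod n (m + 1)
      have h2 := qb_prod (n + 1) m
      have e1 : n + (m + 1) = n + m + 1 := by ring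
      have e2 : n + 1 + m = n + m + 1 := by ring
      have e3 : n + 1 + (m + 1) = (n + m + 1) + 1 := by ring
      rw [e1] at h1
      rw [e2] at h2
      rw [e3, qbinom, qP_succ (n + m + 1)]
      have a := qP_succ n
      have b := qP_succ m
      rw [show n + m + 1 + 1 = (m + 1) + (n + 1) by ring, pow_add X (m + 1)]
      linear_combination (X ^ (m + 1) * (1 - X ^ (n + 1))) * h1 + (1 - X ^ (m + 1)) * h2
        + X ^ (m + 1) * qbinom (n + m + 1) (m + 1) * qP (m + 1) * a
        + qbinom (n + m + 1) m * qP (n + 1) * b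

lemma qb_main (p : ℕ) :
    qbinom (2 * p + 2) p * ∏ i ∈ Finset.range p, (1 - X ^ (i + 1)) =
      ∏ i ∈ Finset.range p, (1 - X ^ (p + 3 + i)) := by
  have h := qb_prod (p + 2) p
  apply mul_right_cancel₀ (qP_ne (p + 2))
  rw [show p + 2 + p = 2 * p + 2 by ring] at h
  change qbinom (2 * p + 2) p * qP p * _ = _
  rw [h, show 2 * p + 2 = (p + 2) + p by ring, qP, Finset.prod_range_add, mul_comm]
  congr 1
  refine Finset.prod_congr rfl fun i _ => ?_
  ring

lemma qb_cancel (k : ℕ) :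
    qbinom (2 * (k + 3) + 2) (k + 3) * ((1 - X) * (1 - X ^ 2) *
        ∏ i ∈ Finset.range k, (1 - X ^ (i + 3))) =
      (1 + X ^ (k + 3)) * ((∏ i ∈ Finset.range k, (1 - X ^ (k + 3 + (i + 3)))) *
        (1 - X ^ (2 * (k + 3) + 1)) * (1 - X ^ (2 * (k + 3) + 2))) := by
  have h := qb_main (k + 3)
  have hne : (1 - X ^ (k + 3) : Polynomial ℤ) ≠ 0 := fun h => by
    have := congrArg (Polynomial.eval 0) h
    simp at this
  apply mul_right_cancel₀ hne
  have e1 : ∏ i ∈ Finset.range (k + 3), (1 - X ^ (i + 1) : Polynomial ℤ) =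
      ((1 - X) * (1 - X ^ 2) * ∏ i ∈ Finset.range k, (1 - X ^ (i + 3))) * (1 - X ^ (k + 3)) := by
    rw [Finset.prod_range_succ, show k + 2 = 2 + k by ring, Finset.prod_range_add,
      Finset.prod_range_succ, Finset.prod_range_one]
    congr 1
    · congr 1
      · simp
      · exact Finset.prod_congr rfl fun i _ => by ring
    · ring
  have e2 : ∏ i ∈ Finset.range (k + 3), (1 - X ^ (k + 3 + 3 + i) : Polynomial ℤ) =
      (∏ i ∈ Finset.range k, (1 - X ^ (k + 3 + (i + 3)))) * (1 - X ^ (2 * (k + 3))) *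
        (1 - X ^ (2 * (k + 3) + 1)) * (1 - X ^ (2 * (k + 3) + 2)) := by
    rw [Finset.prod_range_succ, Finset.prod_range_succ, Finset.prod_range_succ,
      show k + 3 + 3 + k = 2 * (k + 3) by ring,
      show k + 3 + 3 + (k + 1) = 2 * (k + 3) + 1 by ring,
      show k + 3 + 3 + (k + 2) = 2 * (k + 3) + 2 by ring,
      Finset.prod_congr rfl fun i _ => by
        rw [show k + 3 + 3 + i = k + 3 + (i + 3) by ring]]
  rw [e1, e2] at h
  rw [mul_assoc, h]
  ring

lemma cyc_dvd (n : ℕ) (hn : 0 < n) (ζ : ℂ) (hζ : IsPrimitiveRoot ζ n) (f : Polynomial ℤ)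
    (hf : aeval ζ f = 0) : cyclotomic n ℤ ∣ f := by
  rw [cyclotomic_eq_minpoly hζ hn]
  exact minpoly.isIntegrallyClosed_dvd (hζ.isIntegral hn) hf

/-- For an odd prime p, [2p+2 choose p]_q ≡ 1 + q^p (mod [p]_{q²}) in ℤ[q]. -/
theorem qbinom_two_p_add_two_congr (p : ℕ) (hp : p.Prime) (hodd : Odd p) :
    (∑ i ∈ Finset.range p, X ^ (2 * i)) ∣ qbinom (2 * p + 2) p - (1 + X ^ p) := by
  have hp2 : p ≠ 2 := by rintro rfl; exact absurd hodd (by decide)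
  have hp3 : 3 ≤ p := by have := hp.two_le; omega
  haveI := Fact.mk hp
  have hD : (∑ i ∈ Finset.range p, X ^ (2 * i) : Polynomial ℤ) =
      cyclotomic (p * 2) ℤ * cyclotomic p ℤ := by
    rw [← cyclotomic_expand_eq_cyclotomic_mul Nat.prime_two, cyclotomic_prime]
    · simp [map_sum, pow_mul]
    · intro h
      exact (Nat.not_even_iff_odd.2 hodd) (even_iff_two_dvd.2 h)
  rw [hD]
  have d1 : cyclotomic p ℤ ∣ qbinom (2 * p + 2) p - (1 + X ^ p) := by
    have hζ := Complex.isPrimitiveRoot_exp p hp.ne_zero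
    set ζ := Complex.exp (2 * Real.pi * Complex.I / p)
    refine cyc_dvd p hp.pos ζ hζ _ ?_
    obtain ⟨k, rfl⟩ : ∃ k, p = k + 3 := ⟨p - 3, by omega⟩
    have h := congrArg (aeval ζ) (qb_cancel k)
    have h1 := hζ.pow_eq_one
    have hz : ∀ j, 0 < j → j < k + 3 → 1 - ζ ^ j ≠ 0 := fun j h0 hj h =>
      hζ.pow_ne_one_of_pos_of_lt h0.ne' hj (sub_eq_zero.1 h).symm
    simp only [map_mul, map_sub, map_add, map_prod, map_pow, map_one, aeval_X,
      pow_add ζ (k + 3), pow_add ζ (2 * (k + 3)), pow_mul', h1, one_pow, one_mul, pow_one] at h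
    have hne : (1 - ζ) * (1 - ζ ^ 2) * ∏ i ∈ Finset.range k, (1 - ζ ^ (i + 3)) ≠ 0 := by
      refine mul_ne_zero (mul_ne_zero ?_ (hz 2 (by omega) (by omega))) ?_
      · simpa using hz 1 (by omega) (by omega)
      · refine Finset.prod_ne_zero_iff.2 fun i hi => hz _ (by omega) ?_
        have := Finset.mem_range.1 hi
        omega
    apply mul_right_cancel₀ hne
    simp only [map_sub, map_add, map_pow, map_one, aeval_X, h1]
    linear_combination h
  have d2 : cyclotomic (p * 2) ℤ ∣ qbinom (2 * p + 2) p - (1 + X ^ p) := by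
    have hpos : 0 < p * 2 := by omega
    have hζ := Complex.isPrimitiveRoot_exp (p * 2) hpos.ne'
    set ζ := Complex.exp (2 * Real.pi * Complex.I / (p * 2 : ℕ))
    refine cyc_dvd (p * 2) hpos ζ hζ _ ?_
    have h := congrArg (aeval ζ) (qb_main p)
    have h1 := hζ.pow_eq_one
    have hm : ζ ^ p = -1 := by
      have h2 : (ζ ^ p) ^ 2 = 1 := by rw [← pow_mul, h1]
      rcases (sq_eq_sq_iff_eq_or_eq_neg.1 (h2.trans (one_pow 2).symm)) with h3 | h3
      · exact absurd h3 (hζ.pow_ne_one_of_pos_of_lt (by omega) (by omega))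
      · exact h3
    simp only [map_mul, map_sub, map_prod, map_pow, map_one, aeval_X] at h
    rw [Finset.prod_eq_zero (s := Finset.range p) (i := p - 3)
      (f := fun i => 1 - ζ ^ (p + 3 + i)) (Finset.mem_range.2 (by omega))
      (by rw [show p + 3 + (p - 3) = p * 2 by omega, h1, sub_self])] at h
    have hne : ∏ i ∈ Finset.range p, (1 - ζ ^ (i + 1)) ≠ 0 := by
      refine Finset.prod_ne_zero_iff.2 fun i hi h => ?_
      have := Finset.mem_range.1 hi
      exact hζ.pow_ne_one_of_pos_of_lt (by omega) (by omega) (sub_eq_zero.1 h).symm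
    simp only [map_sub, map_add, map_pow, map_one, aeval_X, hm]
    rw [(mul_eq_zero.1 h).resolve_right hne]
    ring
  refine IsRelPrime.mul_dvd ?_ d2 d1
  refine ((cyclotomic.irreducible (by omega)).isRelPrime_iff_not_dvd).2 fun hdvd => ?_
  have := natDegree_le_of_dvd hdvd (cyclotomic_ne_zero _ _)
  have ha := associated_of_dvd_dvd hdvd (((cyclotomic.irreducible (n := p * 2) (by omega)).dvd_symm (cyclotomic.irreducible hp.pos)) hdvd)
  have he := eq_of_monic_of_associated (cyclotomic.monic _ _) (cyclotomic.monic _ _) ha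
  have := cyclotomic_injective (R := ℤ) he
  omega
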